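/- arXiv:1502.03391 — 8 statements merged into one kernel-verified Lean document; each statement's English description precedes it below -/
import Mathlib

section
/- Let N ≥ 1 and let L ∈ ℝ^{N×N} be a symmetric matrix with L·1_N = 0 (all row sums zero), and assume that L + (1/N)·J_N is invertible. Then the matrix M := (L + (1/N)·J_N)^{-1} − (1/N)·J_N is the Moore–Penrose pseudoinverse of L; that is, L·M·L = L, M·L·M = M, and both L·M and M·L are symmetric. -/
open Matrix

/-- If `P` is idempotent with `L * P = P * L = 0` and `B` inverts `L + P`, then both products of
`L` with `B - P` are the complementary idempotent `1 - P`, and `P` annihilates `B - P`. -/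
lemma mul_sub_eq_one_sub_of_add_inverse {R : Type*} [Ring R] {L P B : R}
    (hP : P * P = P) (hLP : L * P = 0) (hPL : P * L = 0)
    (hAB : (L + P) * B = 1) (hBA : B * (L + P) = 1) :
    L * (B - P) = 1 - P ∧ (B - P) * L = 1 - P ∧ P * (B - P) = 0 := by
  have hPB : P * B = P := by
    calc P * B = P * (L + P) * B := by rw [mul_add, hPL, hP, zero_add]
      _ = P := by rw [mul_assoc, hAB, mul_one]
  have hBP : B * P = P := by
    calc B * P = B * ((L + P) * P) := by rw [add_mul, hLP, hP, zero_add]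
      _ = P := by rw [← mul_assoc, hBA, one_mul]
  rw [add_mul, hPB] at hAB
  rw [mul_add, hBP] at hBA
  refine ⟨?_, ?_, ?_⟩
  · rw [mul_sub, hLP, sub_zero, eq_sub_iff_add_eq, hAB]
  · rw [sub_mul, hPL, sub_zero, eq_sub_iff_add_eq, hBA]
  · rw [mul_sub, hPB, hP, sub_self]

/-- If `L` is symmetric with zero row sums and `L + (1/N)·J` is invertible,
then `M := (L + (1/N)·J)⁻¹ − (1/N)·J` is the Moore–Penrose pseudoinverse of `L`. -/
theorem stmt_0 (N : ℕ) (hN : 1 ≤ N) (L : Matrix (Fin N) (Fin N) ℝ)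
    (hsym : L.IsSymm)
    (hrow : L *ᵥ (fun _ => (1 : ℝ)) = 0)
    (J : Matrix (Fin N) (Fin N) ℝ) (hJ : J = Matrix.of fun _ _ => (1 : ℝ))
    (hinv : IsUnit (L + (N : ℝ)⁻¹ • J))
    (M : Matrix (Fin N) (Fin N) ℝ)
    (hM : M = (L + (N : ℝ)⁻¹ • J)⁻¹ - (N : ℝ)⁻¹ • J) :
    L * M * L = L ∧ M * L * M = M ∧ (L * M).IsSymm ∧ (M * L).IsSymm := by
  have hN' : (N : ℝ) ≠ 0 := by positivity
  set P := (N : ℝ)⁻¹ • J with hPdef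
  have hPsymm : P.IsSymm := by
    ext i j
    simp [hPdef, hJ]
  have hP : P * P = P := by
    ext i j
    simp [hPdef, hJ, Matrix.mul_apply, hN']
  have hLP : L * P = 0 := by
    ext i j
    have hi : ∑ k, L i k = 0 := by
      simpa [Matrix.mulVec, dotProduct] using congrFun hrow i
    simp [hPdef, hJ, Matrix.mul_apply, ← Finset.sum_mul, hi]
  have hPL : P * L = 0 := by
    simpa [Matrix.transpose_mul, hsym.eq, hPsymm.eq] using congrArg Matrix.transpose hLP
  have hdet := (Matrix.isUnit_iff_isUnit_det _).mp hinv
  obtain ⟨hLM, hML, hPM⟩ := mul_sub_eq_one_sub_of_add_inverse hP hLP hPL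
    (Matrix.mul_nonsing_inv _ hdet) (Matrix.nonsing_inv_mul _ hdet)
  rw [← hM] at hLM hML hPM
  have hsymm : (1 - P).IsSymm := Matrix.isSymm_one.sub hPsymm
  refine ⟨?_, ?_, hLM ▸ hsymm, hML ▸ hsymm⟩
  · rw [hLM, sub_mul, one_mul, hPL, sub_zero]
  · rw [hML, sub_mul, one_mul, hPM, sub_zero]
end

section
/- Given integers m, n ≥ 1 and a symmetric array of reals (w_{i,j})_{i,j∈[m]} with w_{i,j} ≥ 0 for i ≠ j and w_{i,i} > 0, define 𝒲 ∈ ℝ^{m×m} by 𝒲_{i,i} = n·w_{i,i} + Σ_{j≠i} w_{i,j} and 𝒲_{i,j} = −w_{i,j} for i ≠ j, and let D = diag(w_{1,1},…,w_{m,m}). Assume additionally that 𝒲 + n·((1/(mn))·J_m − D) is invertible. Then the mn×mn matrix 𝒲 ⊗ I_n + ((1/(mn))·J_m − D) ⊗ J_n is invertible, with inverse equal to 𝒲^{-1} ⊗ I_n + 𝒵 ⊗ J_n, where 𝒵 = −(𝒲 + n·((1/(mn))·J_m − D))^{-1} · ((1/(mn))·J_m − D) · 𝒲^{-1}. -/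
open Matrix Kronecker Finset

/-- A Sherman–Morrison–Woodbury-type identity for Kronecker products with a scaled idempotent. -/
theorem kronecker_one_add_kronecker_mul_eq_one {l p R : Type*} [Fintype l] [DecidableEq l]
    [Fintype p] [DecidableEq p] [CommRing R] {W B : Matrix l l R} {J : Matrix p p R} {c : R}
    (hJ : J * J = c • J) (hW : IsUnit W) (hS : IsUnit (W + c • B)) :
    (W ⊗ₖ (1 : Matrix p p R) + B ⊗ₖ J) *
      (W⁻¹ ⊗ₖ (1 : Matrix p p R) + (-((W + c • B)⁻¹ * B * W⁻¹)) ⊗ₖ J) = 1 := by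
  have key : ∀ Z : Matrix l l R, (W ⊗ₖ (1 : Matrix p p R) + B ⊗ₖ J) *
      (W⁻¹ ⊗ₖ (1 : Matrix p p R) + Z ⊗ₖ J) =
      (W * W⁻¹) ⊗ₖ (1 : Matrix p p R) + (B * W⁻¹ + (W + c • B) * Z) ⊗ₖ J := by
    intro Z
    simp only [add_mul, mul_add, ← mul_kronecker_mul, mul_one, one_mul, hJ, kronecker_smul,
      add_kronecker, smul_mul_assoc, smul_kronecker]
    abel
  rw [isUnit_iff_isUnit_det] at hW hS
  rw [key, mul_nonsing_inv _ hW, mul_neg, mul_assoc _ B, mul_nonsing_inv_cancel_left _ _ hS,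
    add_neg_cancel, zero_kronecker, add_zero, one_kronecker_one]

/-- A diagonally shifted weighted Laplacian with positive shifts is invertible. -/
theorem isUnit_shifted_laplacian {ι : Type*} [Fintype ι] [DecidableEq ι] (w : ι → ι → ℝ)
    (d : ι → ℝ) (hw : ∀ i j, i ≠ j → 0 ≤ w i j) (hd : ∀ i, 0 < d i) :
    IsUnit (Matrix.of fun i j =>
      if i = j then d i + ∑ k ∈ univ.erase i, w i k else - w i j) := by
  rw [isUnit_iff_isUnit_det, isUnit_iff_ne_zero]
  refine det_ne_zero_of_sum_row_lt_diag fun i => ?_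
  have hsum : ∑ j ∈ univ.erase i, ‖(Matrix.of fun i j =>
      if i = j then d i + ∑ k ∈ univ.erase i, w i k else - w i j) i j‖ =
      ∑ j ∈ univ.erase i, w i j := by
    refine sum_congr rfl fun j hj => ?_
    have hij := (ne_of_mem_erase hj).symm
    simp [hij, abs_of_nonneg (hw i j hij)]
  rw [hsum, of_apply, if_pos rfl]
  exact (lt_add_of_pos_left _ (hd i)).trans_le (le_abs_self _)

/-- inverse of `𝒲 ⊗ I_n + ((1/(mn))·J_m − D) ⊗ J_n`. -/
theorem stmt_1 (m n : ℕ) (hm : 1 ≤ m) (hn : 1 ≤ n)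
    (w : Fin m → Fin m → ℝ)
    (hsymw : ∀ i j, w i j = w j i)
    (hnonneg : ∀ i j, i ≠ j → 0 ≤ w i j)
    (hpos : ∀ i, 0 < w i i)
    (W : Matrix (Fin m) (Fin m) ℝ)
    (hW : W = fun i j =>
      if i = j then (n : ℝ) * w i i + ∑ k ∈ univ.erase i, w i k else - w i j)
    (D : Matrix (Fin m) (Fin m) ℝ) (hD : D = Matrix.diagonal fun i => w i i)
    (Jm : Matrix (Fin m) (Fin m) ℝ) (hJm : Jm = Matrix.of fun _ _ => (1 : ℝ))
    (Jn : Matrix (Fin n) (Fin n) ℝ) (hJn : Jn = Matrix.of fun _ _ => (1 : ℝ))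
    (hinv : IsUnit (W + (n : ℝ) • (((m : ℝ) * (n : ℝ))⁻¹ • Jm - D)))
    (Z : Matrix (Fin m) (Fin m) ℝ)
    (hZ : Z = -((W + (n : ℝ) • (((m : ℝ) * (n : ℝ))⁻¹ • Jm - D))⁻¹ *
      (((m : ℝ) * (n : ℝ))⁻¹ • Jm - D) * W⁻¹)) :
    IsUnit (W ⊗ₖ (1 : Matrix (Fin n) (Fin n) ℝ) +
      (((m : ℝ) * (n : ℝ))⁻¹ • Jm - D) ⊗ₖ Jn) ∧
    (W ⊗ₖ (1 : Matrix (Fin n) (Fin n) ℝ) +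
      (((m : ℝ) * (n : ℝ))⁻¹ • Jm - D) ⊗ₖ Jn)⁻¹ =
      W⁻¹ ⊗ₖ (1 : Matrix (Fin n) (Fin n) ℝ) + Z ⊗ₖ Jn := by
  have hWu : IsUnit W := by
    rw [hW]
    exact isUnit_shifted_laplacian w (fun i => n * w i i) hnonneg
      fun i => mul_pos (by exact_mod_cast hn) (hpos i)
  have hJ : Jn * Jn = (n : ℝ) • Jn := by
    ext i j
    simp [hJn, mul_apply]
  have h := kronecker_one_add_kronecker_mul_eq_one hJ hWu hinv
  rw [← hZ] at h
  exact ⟨IsUnit.of_mul_eq_one _ h, inv_eq_right_inv h⟩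
end

section
/- Given integers m, n ≥ 1 and a symmetric array of reals (w_{i,j})_{i,j∈[m]} with w_{i,j} ≥ 0 for i ≠ j and w_{i,i} > 0, let W ∈ ℝ^{mn×mn} be the block matrix whose (i,i) diagonal n×n block is w_{i,i}·(J_n − I_n) and whose (i,j) off-diagonal n×n block is w_{i,j}·I_n for i ≠ j, and let L = D_W − W be its combinatorial Laplacian, where D_W is the diagonal matrix of row sums of W. Define 𝒲 ∈ ℝ^{m×m} by 𝒲_{i,i} = n·w_{i,i} + Σ_{j≠i} w_{i,j} and 𝒲_{i,j} = −w_{i,j} for i ≠ j, let D = diag(w_{1,1},…,w_{m,m}), and assume 𝒲 + n·((1/(mn))·J_m − D) is invertible. Then the Moore–Penrose pseudoinverse of L is L† = 𝒲^{-1} ⊗ I_n + [−(𝒲 + n·((1/(mn))·J_m − D))^{-1} · ((1/(mn))·J_m − D) · 𝒲^{-1} − (1/(mn))·J_m] ⊗ J_n; that is, setting M equal to this matrix, one has L·M·L = L, M·L·M = M, and L·M and M·L are symmetric. -/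
open Matrix Kronecker Finset

/-- If `P` is a symmetric idempotent with `L * P = P * L = 0` and `N` inverts `L + P`, then
`N - P` is the Moore–Penrose pseudoinverse of `L`. -/
theorem moorePenrose_sub_of_mul_eq_one {ι R : Type*} [Fintype ι] [DecidableEq ι] [CommRing R]
    {L P N : Matrix ι ι R} (hP : P * P = P) (hPs : P.IsSymm) (hLP : L * P = 0)
    (hPL : P * L = 0) (hN : (L + P) * N = 1) :
    L * (N - P) * L = L ∧ (N - P) * L * (N - P) = N - P ∧
      (L * (N - P)).IsSymm ∧ ((N - P) * L).IsSymm := by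
  have hN' : N * (L + P) = 1 := mul_eq_one_comm.mp hN
  have hNP : N * P = P := by
    calc N * P = N * ((L + P) * P) := by rw [add_mul, hLP, hP, zero_add]
      _ = P := by rw [← mul_assoc, hN', one_mul]
  have hPN : P * N = P := by
    calc P * N = P * (L + P) * N := by rw [mul_add, hPL, hP, zero_add]
      _ = P := by rw [mul_assoc, hN, mul_one]
  have hLM : L * (N - P) = 1 - P := by
    rw [mul_sub, hLP, sub_zero, ← hN, add_mul, hPN, add_sub_cancel_right]
  have hML : (N - P) * L = 1 - P := by
    rw [sub_mul, hPL, sub_zero, ← hN', mul_add, hNP, add_sub_cancel_right]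
  have hs : (1 - P).IsSymm := Matrix.isSymm_one.sub hPs
  refine ⟨?_, ?_, hLM ▸ hs, hML ▸ hs⟩
  · rw [hLM, sub_mul, hPL, one_mul, sub_zero]
  · rw [hML, sub_mul, one_mul, mul_sub, hPN, hP, sub_self, sub_zero]

/-- The inverse of `A ⊗ 1 + E ⊗ J`, where `J * J = c • J`. -/
theorem kronecker_one_add_mul_inv {ι κ R : Type*} [Fintype ι] [DecidableEq ι] [Fintype κ]
    [DecidableEq κ] [CommRing R] {A E : Matrix ι ι R} {J : Matrix κ κ R} {c : R}
    (hJ : J * J = c • J) (hA : IsUnit A) (hAE : IsUnit (A + c • E)) :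
    (A ⊗ₖ (1 : Matrix κ κ R) + E ⊗ₖ J) *
      (A⁻¹ ⊗ₖ (1 : Matrix κ κ R) + (-((A + c • E)⁻¹ * E * A⁻¹)) ⊗ₖ J) = 1 := by
  have h1 : A * A⁻¹ = 1 := Matrix.mul_nonsing_inv _ ((Matrix.isUnit_iff_isUnit_det _).mp hA)
  have h2 : (A + c • E) * (A + c • E)⁻¹ = 1 :=
    Matrix.mul_nonsing_inv _ ((Matrix.isUnit_iff_isUnit_det _).mp hAE)
  set X := -((A + c • E)⁻¹ * E * A⁻¹) with hX
  have h3 : A * X + E * A⁻¹ + c • (E * X) = 0 := by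
    have : (A + c • E) * X = -(E * A⁻¹) := by
      rw [hX, mul_neg, ← mul_assoc, ← mul_assoc, h2, one_mul]
    rw [add_mul, smul_mul_assoc] at this
    rw [add_right_comm, this, neg_add_cancel]
  rw [add_mul, mul_add, mul_add, ← mul_kronecker_mul, ← mul_kronecker_mul, ← mul_kronecker_mul,
    ← mul_kronecker_mul, h1, hJ, one_mul, one_mul, mul_one, kronecker_smul, ← smul_kronecker,
    one_kronecker_one, add_assoc, ← add_kronecker, ← add_kronecker, ← add_assoc, h3,
    zero_kronecker, add_zero]

/-- The Kronecker product distributes over subtraction on the left. -/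
theorem kronecker_sub_left {ι κ R : Type*} [CommRing R] (A B : Matrix ι ι R) (C : Matrix κ κ R) :
    (A - B) ⊗ₖ C = A ⊗ₖ C - B ⊗ₖ C := by
  ext p q
  exact sub_mul _ _ _

/-- Products of constant-one matrices. -/
theorem ones_mul_ones (k : ℕ) :
    (Matrix.of fun _ _ => (1 : ℝ) : Matrix (Fin k) (Fin k) ℝ) * (Matrix.of fun _ _ => (1 : ℝ)) =
      (k : ℝ) • (Matrix.of fun _ _ => (1 : ℝ)) := by
  ext i j
  simp [Matrix.mul_apply]

/-- explicit Moore–Penrose pseudoinverse of the combinatorial Laplacian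
of the JOFC weight matrix. -/
theorem stmt_2 (m n : ℕ) (hm : 1 ≤ m) (hn : 1 ≤ n)
    (w : Fin m → Fin m → ℝ)
    (hsymw : ∀ i j, w i j = w j i)
    (hnonneg : ∀ i j, i ≠ j → 0 ≤ w i j)
    (hpos : ∀ i, 0 < w i i)
    (Wbig : Matrix (Fin m × Fin n) (Fin m × Fin n) ℝ)
    (hWbig : Wbig = fun p q =>
      if p.1 = q.1 then (if p.2 = q.2 then 0 else w p.1 p.1)
      else (if p.2 = q.2 then w p.1 q.1 else 0))
    (L : Matrix (Fin m × Fin n) (Fin m × Fin n) ℝ)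
    (hL : L = Matrix.diagonal (fun p => ∑ q, Wbig p q) - Wbig)
    (W : Matrix (Fin m) (Fin m) ℝ)
    (hW : W = fun i j =>
      if i = j then (n : ℝ) * w i i + ∑ k ∈ univ.erase i, w i k else - w i j)
    (D : Matrix (Fin m) (Fin m) ℝ) (hD : D = Matrix.diagonal fun i => w i i)
    (Jm : Matrix (Fin m) (Fin m) ℝ) (hJm : Jm = Matrix.of fun _ _ => (1 : ℝ))
    (Jn : Matrix (Fin n) (Fin n) ℝ) (hJn : Jn = Matrix.of fun _ _ => (1 : ℝ))
    (hinv : IsUnit (W + (n : ℝ) • (((m : ℝ) * (n : ℝ))⁻¹ • Jm - D)))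
    (M : Matrix (Fin m × Fin n) (Fin m × Fin n) ℝ)
    (hM : M = W⁻¹ ⊗ₖ (1 : Matrix (Fin n) (Fin n) ℝ) +
      (-((W + (n : ℝ) • (((m : ℝ) * (n : ℝ))⁻¹ • Jm - D))⁻¹ *
          (((m : ℝ) * (n : ℝ))⁻¹ • Jm - D) * W⁻¹)
        - ((m : ℝ) * (n : ℝ))⁻¹ • Jm) ⊗ₖ Jn) :
    L * M * L = L ∧ M * L * M = M ∧ (L * M).IsSymm ∧ (M * L).IsSymm := by
  have hm0 : (m : ℝ) ≠ 0 := by positivity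
  have hn0 : (n : ℝ) ≠ 0 := by positivity
  have hJJ : Jn * Jn = (n : ℝ) • Jn := by rw [hJn]; exact ones_mul_ones n
  have hJJm : Jm * Jm = (m : ℝ) • Jm := by rw [hJm]; exact ones_mul_ones m
  have hWu : IsUnit W := by
    rw [Matrix.isUnit_iff_isUnit_det, isUnit_iff_ne_zero]
    refine det_ne_zero_of_sum_row_lt_diag fun i => ?_
    have hs : ∑ j ∈ univ.erase i, ‖W i j‖ = ∑ j ∈ univ.erase i, w i j := by
      refine Finset.sum_congr rfl fun j hj => ?_
      have hij : i ≠ j := (Finset.ne_of_mem_erase hj).symm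
      rw [hW]
      simp [hij, abs_of_nonneg (hnonneg i j hij)]
    have hd : W i i = (n : ℝ) * w i i + ∑ k ∈ univ.erase i, w i k := by
      rw [hW]
      simp
    have hlt : 0 < (n : ℝ) * w i i := mul_pos (by positivity) (hpos i)
    rw [hs, hd]
    exact lt_of_lt_of_le (lt_add_of_pos_left _ hlt) (le_abs_self _)
  have hrow : ∀ i, ∀ a, ∑ q, Wbig (i, a) q =
      ((n : ℝ) - 1) * w i i + ∑ k ∈ univ.erase i, w i k := by
    intro i a
    rw [hWbig, Fintype.sum_prod_type, ← Finset.add_sum_erase _ _ (Finset.mem_univ i)]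
    congr 1
    · have : ∀ b : Fin n, (if a = b then 0 else w i i) = w i i - if a = b then w i i else 0 := by
        intro b
        split_ifs <;> simp
      simp [this]
      ring
    · refine Finset.sum_congr rfl fun j hj => ?_
      simp [(Finset.ne_of_mem_erase hj).symm]
  have hLk : L = W ⊗ₖ (1 : Matrix (Fin n) (Fin n) ℝ) - D ⊗ₖ Jn := by
    ext ⟨i, a⟩ ⟨j, b⟩
    rw [hL, Matrix.sub_apply, Matrix.sub_apply, kronecker_apply,
      kronecker_apply, Matrix.diagonal_apply, hrow, hWbig, hW, hD, hJn]
    by_cases hij : i = j <;> by_cases hab : a = b <;>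
      simp [hij, hab, Matrix.one_apply]
    ring
  set P : Matrix (Fin m × Fin n) (Fin m × Fin n) ℝ := (((m : ℝ) * (n : ℝ))⁻¹ • Jm) ⊗ₖ Jn with hPd
  have hPapp : ∀ p q, P p q = ((m : ℝ) * (n : ℝ))⁻¹ := by
    intro p q
    simp [hPd, hJm, hJn]
  have hPs : P.IsSymm := by
    ext p q
    rw [Matrix.transpose_apply, hPapp, hPapp]
  have hPP : P * P = P := by
    rw [hPd, ← mul_kronecker_mul, hJJ, smul_mul_smul_comm, hJJm, kronecker_smul,
      ← smul_kronecker, smul_smul, smul_smul]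
    congr 2
    field_simp
  have hLs : L.IsSymm := by
    ext p q
    rw [Matrix.transpose_apply, hL, Matrix.sub_apply, Matrix.sub_apply, hWbig]
    by_cases hpq : p = q
    · rw [hpq]
    · rw [Matrix.diagonal_apply_ne _ hpq, Matrix.diagonal_apply_ne' _ hpq]
      by_cases h1 : p.1 = q.1 <;> simp [h1, eq_comm, hsymw q.1 p.1]
  have hLP : L * P = 0 := by
    ext p q
    simp [Matrix.mul_apply, hPapp, ← Finset.sum_mul, hL, Finset.sum_sub_distrib,
      Matrix.diagonal_apply]
  have hPL : P * L = 0 := by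
    rw [← Matrix.transpose_inj, Matrix.transpose_mul, hPs.eq, hLs.eq, hLP, Matrix.transpose_zero]
  have hK : L + P = W ⊗ₖ (1 : Matrix (Fin n) (Fin n) ℝ) +
      (((m : ℝ) * (n : ℝ))⁻¹ • Jm - D) ⊗ₖ Jn := by
    rw [hLk, hPd, kronecker_sub_left]
    abel
  have hN := kronecker_one_add_mul_inv hJJ hWu hinv
  rw [← hK] at hN
  rw [kronecker_sub_left, ← add_sub_assoc] at hM
  rw [hM]
  exact moorePenrose_sub_of_mul_eq_one hPP hPs hLP hPL hN
end

section
/- Let n ≥ 1 be an integer and let A, B ∈ ℝ^{m×m} be matrices such that A and A + n·B are invertible. Then the matrix A ⊗ I_n + B ⊗ J_n ∈ ℝ^{mn×mn} is invertible, with inverse (A ⊗ I_n + B ⊗ J_n)^{-1} = A^{-1} ⊗ I_n − ((A + n·B)^{-1}·B·A^{-1}) ⊗ J_n. -/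
open Matrix Kronecker

/-- Woodbury-type identity for sums of Kronecker products:
`(A ⊗ I_n + B ⊗ J_n)⁻¹ = A⁻¹ ⊗ I_n − ((A + n·B)⁻¹·B·A⁻¹) ⊗ J_n`. -/
theorem stmt_3 (m n : ℕ) (hn : 1 ≤ n)
    (A B : Matrix (Fin m) (Fin m) ℝ)
    (hA : IsUnit A) (hAnB : IsUnit (A + (n : ℝ) • B))
    (Jn : Matrix (Fin n) (Fin n) ℝ) (hJn : Jn = Matrix.of fun _ _ => (1 : ℝ)) :
    IsUnit (A ⊗ₖ (1 : Matrix (Fin n) (Fin n) ℝ) + B ⊗ₖ Jn) ∧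
    (A ⊗ₖ (1 : Matrix (Fin n) (Fin n) ℝ) + B ⊗ₖ Jn)⁻¹ =
      A⁻¹ ⊗ₖ (1 : Matrix (Fin n) (Fin n) ℝ) -
      ((A + (n : ℝ) • B)⁻¹ * B * A⁻¹) ⊗ₖ Jn := by
  have hJ : Jn * Jn = (n : ℝ) • Jn := by
    subst hJn
    ext i j
    simp [Matrix.mul_apply]
  have hA' : A⁻¹ * A = 1 := Matrix.nonsing_inv_mul A ((Matrix.isUnit_iff_isUnit_det A).mp hA)
  have hC := Matrix.nonsing_inv_mul _ ((Matrix.isUnit_iff_isUnit_det _).mp hAnB)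
  set C := (A + (n : ℝ) • B)⁻¹
  have hAB : A⁻¹ * B = C * B + (n : ℝ) • (C * B * A⁻¹ * B) := by
    have hA'' : A * A⁻¹ = 1 := Matrix.mul_nonsing_inv A ((Matrix.isUnit_iff_isUnit_det A).mp hA)
    calc A⁻¹ * B = C * (A + (n : ℝ) • B) * (A⁻¹ * B) := by rw [hC, one_mul]
      _ = C * (A * A⁻¹) * B + (n : ℝ) • (C * B * A⁻¹ * B) := by
        simp only [mul_add, add_mul, Matrix.mul_smul, Matrix.smul_mul, mul_assoc]
      _ = _ := by rw [hA'', mul_one]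
  have hinv : (A⁻¹ ⊗ₖ (1 : Matrix (Fin n) (Fin n) ℝ) - (C * B * A⁻¹) ⊗ₖ Jn) *
      (A ⊗ₖ (1 : Matrix (Fin n) (Fin n) ℝ) + B ⊗ₖ Jn) = 1 := by
    rw [sub_mul, mul_add, mul_add]
    simp only [← Matrix.mul_kronecker_mul, one_mul, mul_one, hJ, hA', Matrix.one_kronecker_one]
    rw [mul_assoc (C * B), hA', mul_one, hAB, Matrix.add_kronecker, Matrix.kronecker_smul,
      Matrix.smul_kronecker]
    abel
  exact ⟨IsUnit.of_mul_eq_one_right _ hinv, Matrix.inv_eq_left_inv hinv⟩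
end

section
/- Given integers m, n ≥ 1 and a symmetric array of reals (w_{i,j})_{i,j∈[m]}, let W ∈ ℝ^{mn×mn} be the block matrix whose (i,i) diagonal n×n block is w_{i,i}·(J_n − I_n) and whose (i,j) off-diagonal n×n block is w_{i,j}·I_n for i ≠ j. Then the combinatorial Laplacian L = D_W − W of W, where D_W is the diagonal matrix of row sums of W, equals 𝒲 ⊗ I_n − D ⊗ J_n, where 𝒲 ∈ ℝ^{m×m} is defined by 𝒲_{i,i} = n·w_{i,i} + Σ_{j≠i} w_{i,j} and 𝒲_{i,j} = −w_{i,j} for i ≠ j, and D = diag(w_{1,1},…,w_{m,m}). -/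
open Matrix Kronecker Finset

/-- The row sums of the block matrix with diagonal blocks `w i i • (J - 1)` and off-diagonal
blocks `w i j • 1`. -/
theorem jofc_row_sum {ι : Type*} [Fintype ι] [DecidableEq ι] (n : ℕ) (w : ι → ι → ℝ)
    (i : ι) (a : Fin n) :
    ∑ q : ι × Fin n,
      (if i = q.1 then (if a = q.2 then 0 else w i i) else (if a = q.2 then w i q.1 else 0)) =
      ((n : ℝ) - 1) * w i i + ∑ k ∈ univ.erase i, w i k := by
  rw [Fintype.sum_prod_type, ← Finset.add_sum_erase _ _ (mem_univ i)]
  congr 1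
  · have h (b : Fin n) : (if a = b then 0 else w i i) = w i i - if a = b then w i i else 0 := by
      split_ifs <;> ring
    simp only [if_true, h, sum_sub_distrib, sum_const, card_univ, Fintype.card_fin,
      nsmul_eq_mul, sum_ite_eq, mem_univ]
    ring
  · refine sum_congr rfl fun k hk => ?_
    simp [(ne_of_mem_erase hk).symm]

/-- the combinatorial Laplacian of the JOFC weight matrix equals
`𝒲 ⊗ I_n − D ⊗ J_n`. -/
theorem stmt_4 (m n : ℕ) (hm : 1 ≤ m) (hn : 1 ≤ n)
    (w : Fin m → Fin m → ℝ)
    (hsymw : ∀ i j, w i j = w j i)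
    (Wbig : Matrix (Fin m × Fin n) (Fin m × Fin n) ℝ)
    (hWbig : Wbig = fun p q =>
      if p.1 = q.1 then (if p.2 = q.2 then 0 else w p.1 p.1)
      else (if p.2 = q.2 then w p.1 q.1 else 0))
    (L : Matrix (Fin m × Fin n) (Fin m × Fin n) ℝ)
    (hL : L = Matrix.diagonal (fun p => ∑ q, Wbig p q) - Wbig)
    (W : Matrix (Fin m) (Fin m) ℝ)
    (hW : W = fun i j =>
      if i = j then (n : ℝ) * w i i + ∑ k ∈ univ.erase i, w i k else - w i j)
    (D : Matrix (Fin m) (Fin m) ℝ) (hD : D = Matrix.diagonal fun i => w i i)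
    (Jn : Matrix (Fin n) (Fin n) ℝ) (hJn : Jn = Matrix.of fun _ _ => (1 : ℝ)) :
    L = W ⊗ₖ (1 : Matrix (Fin n) (Fin n) ℝ) - D ⊗ₖ Jn := by
  subst hWbig hL hW hD hJn
  ext ⟨i, a⟩ ⟨j, b⟩
  change Matrix.diagonal _ (i, a) (j, b) -
      (if i = j then (if a = b then 0 else w i i) else (if a = b then w i j else 0)) =
    (if i = j then (n : ℝ) * w i i + ∑ k ∈ univ.erase i, w i k else - w i j) *
      (1 : Matrix (Fin n) (Fin n) ℝ) a b - Matrix.diagonal (fun i => w i i) i j * 1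
  rw [Matrix.diagonal_apply, jofc_row_sum]
  by_cases hij : i = j
  · subst hij
    by_cases hab : a = b
    · subst hab
      simp only [Matrix.diagonal_apply_eq, Matrix.one_apply_eq, if_true]
      ring
    · simp [hab]
  · by_cases hab : a = b <;> simp [Matrix.one_apply, hij, hab]
end

section
/- Let m, n ≥ 1 be integers and w > 0 a real number, and let 𝒲 = (n + m·w)·I_m − w·J_m ∈ ℝ^{m×m}. Then the matrix 𝒲 + n·((1/(mn))·J_m − I_m) is invertible, and the matrix −(𝒲 + n·((1/(mn))·J_m − I_m))^{-1} · ((1/(mn))·J_m − I_m) · 𝒲^{-1} − (1/(mn))·J_m has all diagonal entries equal to (−m²·w² + m·n² − m·n·w − n²)/(w·n²·m²·(n + w·m)) and all off-diagonal entries equal to (−m²·w² − m·n·w − n²)/(w·n²·m²·(n + w·m)). -/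
open Matrix

/-- The product of two matrices of the form `a • 1 + b • J`, where `J` is the all-ones matrix. -/
theorem smul_one_add_smul_ones_mul {R ι : Type*} [CommRing R] [Fintype ι] [DecidableEq ι]
    (a b c d : R) :
    (a • (1 : Matrix ι ι R) + b • Matrix.of fun _ _ => 1) *
        (c • (1 : Matrix ι ι R) + d • Matrix.of fun _ _ => 1) =
      (a * c) • (1 : Matrix ι ι R) +
        (a * d + b * c + b * d * Fintype.card ι) • Matrix.of fun _ _ => 1 := by
  have h : (Matrix.of fun _ _ => 1 : Matrix ι ι R) * (Matrix.of fun _ _ => 1) =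
      (Fintype.card ι : R) • Matrix.of fun _ _ => 1 := by
    ext i j
    simp [Matrix.mul_apply]
  simp only [add_mul, mul_add, smul_mul_assoc, mul_smul_comm, h, one_mul, mul_one]
  module

/-- entries of the matrix
`−(𝒲 + n·((1/(mn))·J_m − I_m))⁻¹ · ((1/(mn))·J_m − I_m) · 𝒲⁻¹ − (1/(mn))·J_m`
where `𝒲 = (n + m·w)·I_m − w·J_m`. -/
theorem stmt_6 (m n : ℕ) (hm : 1 ≤ m) (hn : 1 ≤ n) (w : ℝ) (hw : 0 < w)
    (J : Matrix (Fin m) (Fin m) ℝ) (hJ : J = Matrix.of fun _ _ => (1 : ℝ))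
    (W : Matrix (Fin m) (Fin m) ℝ)
    (hW : W = ((n : ℝ) + (m : ℝ) * w) • (1 : Matrix (Fin m) (Fin m) ℝ) - w • J)
    (E : Matrix (Fin m) (Fin m) ℝ)
    (hE : E = ((m : ℝ) * (n : ℝ))⁻¹ • J - (1 : Matrix (Fin m) (Fin m) ℝ))
    (M : Matrix (Fin m) (Fin m) ℝ)
    (hM : M = -((W + (n : ℝ) • E)⁻¹ * E * W⁻¹) - ((m : ℝ) * (n : ℝ))⁻¹ • J) :
    IsUnit (W + (n : ℝ) • E) ∧
    (∀ i, M i i =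
      (-(m : ℝ)^2 * w^2 + (m : ℝ) * (n : ℝ)^2 - (m : ℝ) * (n : ℝ) * w - (n : ℝ)^2) /
        (w * (n : ℝ)^2 * (m : ℝ)^2 * ((n : ℝ) + w * (m : ℝ)))) ∧
    (∀ i j, i ≠ j → M i j =
      (-(m : ℝ)^2 * w^2 - (m : ℝ) * (n : ℝ) * w - (n : ℝ)^2) /
        (w * (n : ℝ)^2 * (m : ℝ)^2 * ((n : ℝ) + w * (m : ℝ)))) := by
  subst hJ
  have hm0 : (m : ℝ) ≠ 0 := by positivity
  have hn0 : (n : ℝ) ≠ 0 := by positivity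
  have hw0 : w ≠ 0 := hw.ne'
  have hs : (n : ℝ) + m * w ≠ 0 := by positivity
  set J : Matrix (Fin m) (Fin m) ℝ := Matrix.of fun _ _ => (1 : ℝ) with hJ
  have hmul (a b c d : ℝ) : (a • (1 : Matrix (Fin m) (Fin m) ℝ) + b • J) * (c • 1 + d • J) =
      (a * c) • 1 + (a * d + b * c + b * d * m) • J := by
    simpa only [Fintype.card_fin] using smul_one_add_smul_ones_mul (ι := Fin m) a b c d
  have hE' : E = (-1 : ℝ) • 1 + ((m : ℝ) * n)⁻¹ • J := by
    rw [hE]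
    module
  have hW' : W = ((n : ℝ) + m * w) • 1 + (-w) • J := by
    rw [hW]
    module
  have hA : W + (n : ℝ) • E = (m * w) • 1 + ((m : ℝ)⁻¹ - w) • J := by
    have h : (m : ℝ)⁻¹ - w = n * ((m : ℝ) * n)⁻¹ - w := by field_simp
    rw [h, hW, hE]
    module
  have hAinv : (W + (n : ℝ) • E) *
      ((m * w)⁻¹ • 1 + ((1 - (m * w)⁻¹) / m) • J) = 1 := by
    have h₁ : m * w * (m * w)⁻¹ = 1 := by field_simp
    have h₂ : m * w * ((1 - (m * w)⁻¹) / m) + ((m : ℝ)⁻¹ - w) * (m * w)⁻¹ +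
        ((m : ℝ)⁻¹ - w) * ((1 - (m * w)⁻¹) / m) * m = 0 := by
      field_simp
      ring
    rw [hA, hmul, h₁, h₂, one_smul, zero_smul, add_zero]
  have hWinv : W * (((n : ℝ) + m * w)⁻¹ • 1 + (w / (n * (n + m * w))) • J) = 1 := by
    have h₁ : ((n : ℝ) + m * w) * ((n : ℝ) + m * w)⁻¹ = 1 := by field_simp
    have h₂ : ((n : ℝ) + m * w) * (w / (n * (n + m * w))) + -w * ((n : ℝ) + m * w)⁻¹ +
        -w * (w / (n * (n + m * w))) * m = 0 := by
      field_simp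
      ring
    rw [hW', hmul, h₁, h₂, one_smul, zero_smul, add_zero]
  refine ⟨IsUnit.of_mul_eq_one _ hAinv, fun i => ?_, fun i j hij => ?_⟩
  · rw [hM, Matrix.inv_eq_right_inv hAinv, Matrix.inv_eq_right_inv hWinv, hE', hmul, hmul]
    simp only [hJ, Matrix.sub_apply, Matrix.neg_apply, Matrix.add_apply, Matrix.smul_apply,
      Matrix.of_apply, Matrix.one_apply_eq, smul_eq_mul, mul_one]
    field_simp
    ring
  · rw [hM, Matrix.inv_eq_right_inv hAinv, Matrix.inv_eq_right_inv hWinv, hE', hmul, hmul]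
    simp only [hJ, Matrix.sub_apply, Matrix.neg_apply, Matrix.add_apply, Matrix.smul_apply,
      Matrix.of_apply, Matrix.one_apply_ne hij, smul_eq_mul, mul_one, mul_zero, zero_add]
    field_simp
    ring
end

section
/- Let m, n, d ≥ 1 be integers, w ≥ 0 a real number, and Δ_1, …, Δ_m ∈ ℝ^{n×n} symmetric matrices. Let Δ ∈ ℝ^{mn×mn} be the block matrix whose (i,i) diagonal n×n block is Δ_i and whose off-diagonal blocks are zero, and let W ∈ ℝ^{mn×mn} be the block matrix whose (i,i) diagonal n×n block is J_n − I_n and whose off-diagonal n×n blocks are w·I_n. Then for any configuration X ∈ ℝ^{mn×d} partitioned into n×d blocks X^{(1)}, …, X^{(m)} with rows X^{(i)}_1, …, X^{(i)}_n, one has Σ_{1 ≤ p < q ≤ mn} W_{p,q}·(Δ_{p,q} − ‖X_p − X_q‖)² = Σ_{i=1}^m Σ_{1 ≤ j < ℓ ≤ n} ([Δ_i]_{j,ℓ} − ‖X^{(i)}_j − X^{(i)}_ℓ‖)² + w·Σ_{1 ≤ i < j ≤ m} Σ_{ℓ=1}^n ‖X^{(i)}_ℓ − X^{(j)}_ℓ‖²,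 i.e., the weighted raw stress of the omnibus matrix equals the fidelity term plus w times the commensurability term. -/
open Matrix Finset

/-- Euclidean distance between rows `i` and `j` of `X`. -/
noncomputable def rowDist {I : Type*} {d : ℕ} (X : Matrix I (Fin d) ℝ) (i j : I) : ℝ :=
  Real.sqrt (∑ c : Fin d, (X i c - X j c) ^ 2)

theorem rowDist_sq {I : Type*} {d : ℕ} (X : Matrix I (Fin d) ℝ) (i j : I) :
    rowDist X i j ^ 2 = ∑ c : Fin d, (X i c - X j c) ^ 2 :=
  Real.sq_sqrt (Finset.sum_nonneg fun _ _ => sq_nonneg _)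

/-- the weighted raw stress of the JOFC omnibus matrix equals the
fidelity term plus `w` times the commensurability term.  Pairs `p < q` of omnibus
indices are ordered block-lexicographically (block index first). -/
theorem stmt_10 (m n d : ℕ) (hm : 1 ≤ m) (hn : 1 ≤ n) (hd : 1 ≤ d)
    (w : ℝ) (hw : 0 ≤ w)
    (Δ : Fin m → Matrix (Fin n) (Fin n) ℝ) (hΔ : ∀ i, (Δ i).IsSymm)
    (Δbig : Matrix (Fin m × Fin n) (Fin m × Fin n) ℝ)
    (hΔbig : Δbig = fun p q => if p.1 = q.1 then Δ p.1 p.2 q.2 else 0)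
    (W : Matrix (Fin m × Fin n) (Fin m × Fin n) ℝ)
    (hW : W = fun p q =>
      if p.1 = q.1 then (if p.2 = q.2 then 0 else 1)
      else (if p.2 = q.2 then w else 0))
    (X : Matrix (Fin m × Fin n) (Fin d) ℝ) :
    (∑ p : Fin m × Fin n, ∑ q : Fin m × Fin n,
      if p.1 < q.1 ∨ (p.1 = q.1 ∧ p.2 < q.2) then
        W p q * (Δbig p q - rowDist X p q) ^ 2 else 0) =
    (∑ i : Fin m, ∑ j : Fin n, ∑ l : Fin n,
      if j < l then (Δ i j l - rowDist X (i, j) (i, l)) ^ 2 else 0) +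
    w * ∑ i : Fin m, ∑ j : Fin m,
      if i < j then ∑ l : Fin n, ∑ c : Fin d, (X (i, l) c - X (j, l) c) ^ 2 else 0 := by
  subst hΔbig hW
  have summand_split : ∀ p q : Fin m × Fin n,
      (if p.1 < q.1 ∨ (p.1 = q.1 ∧ p.2 < q.2) then
        (if p.1 = q.1 then (if p.2 = q.2 then 0 else 1) else (if p.2 = q.2 then w else 0)) *
          ((if p.1 = q.1 then Δ p.1 p.2 q.2 else 0) - rowDist X p q) ^ 2 else 0) =
      (if p.1 = q.1 then
        (if p.2 < q.2 then (Δ p.1 p.2 q.2 - rowDist X p (p.1, q.2)) ^ 2 else 0) else 0) +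
      (if p.2 = q.2 then
        (if p.1 < q.1 then w * ∑ c : Fin d, (X p c - X (q.1, p.2) c) ^ 2 else 0) else 0) := by
    rintro ⟨i, j⟩ ⟨k, l⟩
    rcases eq_or_ne i k with rfl | hik
    · by_cases hjl : j < l
      · simp [hjl, hjl.ne]
      · simp [hjl]
    · rcases eq_or_ne j l with rfl | hjl
      · simp [hik, rowDist_sq]
      · simp [hik, hjl]
  simp only [summand_split, Finset.sum_add_distrib, Fintype.sum_prod_type]
  congr 1
  · refine Finset.sum_congr rfl fun i _ => Finset.sum_congr rfl fun j _ => ?_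
    rw [Finset.sum_comm]
    simp
  · simp only [Finset.mul_sum, Finset.sum_ite_eq, Finset.mem_univ, if_true]
    refine Finset.sum_congr rfl fun i _ => ?_
    rw [Finset.sum_comm]
    refine Finset.sum_congr rfl fun j _ => ?_
    split_ifs <;> simp [Finset.mul_sum]
end

section
/- Let W, Δ ∈ ℝ^{N×N} be symmetric matrices, let L = D_W − W be the combinatorial Laplacian of W, and for X ∈ ℝ^{N×d} define B(X) ∈ ℝ^{N×N} by B(X)_{i,j} = −W_{i,j}·Δ_{i,j}/‖X_i − X_j‖ if i ≠ j and ‖X_i − X_j‖ ≠ 0, B(X)_{i,j} = 0 if i ≠ j and ‖X_i − X_j‖ = 0, and B(X)_{i,i} = −Σ_{k≠i} B(X)_{i,k}. Defining the raw stress σ(X) = Σ_{1 ≤ i < j ≤ N} W_{i,j}·(Δ_{i,j} − ‖X_i − X_j‖)², one has σ(X) = Σ_{1 ≤ i < j ≤ N} W_{i,j}·Δ_{i,j}² + trace(X^⊤·L·X) − 2·trace(X^⊤·B(X)·X) for every X ∈ ℝ^{N×d}. -/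
open Matrix Finset

theorem rowDist_comm {I : Type*} {d : ℕ} (X : Matrix I (Fin d) ℝ) (i j : I) :
    rowDist X i j = rowDist X j i := by
  unfold rowDist
  congr 1
  exact Finset.sum_congr rfl fun c _ => by ring

/-- A double sum of a symmetric function vanishing on the diagonal is twice its strict upper
triangular part. -/
theorem sum_sum_eq_two_mul_sum_lt {I : Type*} [Fintype I] [LinearOrder I] (f : I → I → ℝ)
    (hsymm : ∀ i j, f i j = f j i) (hdiag : ∀ i, f i i = 0) :
    ∑ i, ∑ j, f i j = 2 * ∑ i, ∑ j, if i < j then f i j else 0 := by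
  have hswap : (∑ i, ∑ j, if i < j then f i j else 0) =
      ∑ i, ∑ j, if j < i then f i j else 0 := by
    rw [Finset.sum_comm]
    simp only [hsymm]
  rw [two_mul]
  nth_rewrite 2 [hswap]
  simp only [← Finset.sum_add_distrib]
  refine Finset.sum_congr rfl fun i _ => Finset.sum_congr rfl fun j _ => ?_
  rcases lt_trichotomy i j with h | rfl | h
  · simp [h, h.not_gt]
  · simp [hdiag]
  · simp [h, h.not_gt]

/-- The Laplacian quadratic form as a sum over pairs. -/
theorem trace_transpose_mul_mul_eq_sum_lt {I : Type*} [Fintype I] [LinearOrder I] {d : ℕ}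
    (M : Matrix I I ℝ) (hM : M.IsSymm) (hrow : ∀ i, ∑ j, M i j = 0)
    (X : Matrix I (Fin d) ℝ) :
    Matrix.trace (Xᵀ * M * X) =
      ∑ i, ∑ j, if i < j then -(M i j * rowDist X i j ^ 2) else 0 := by
  have htrace : Matrix.trace (Xᵀ * M * X) = ∑ i, ∑ j, M i j * ∑ c, X i c * X j c := by
    simp only [Matrix.trace, Matrix.diag, Matrix.mul_apply, Matrix.transpose_apply,
      Finset.sum_mul, Finset.mul_sum]
    rw [Finset.sum_comm]
    simp_rw [Finset.sum_comm (s := (univ : Finset (Fin d)))]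
    rw [Finset.sum_comm]
    refine Finset.sum_congr rfl fun i _ => Finset.sum_congr rfl fun j _ =>
      Finset.sum_congr rfl fun c _ => ?_
    ring
  have hcol : ∀ j, ∑ i, M i j = 0 := fun j => by
    simpa only [hM.apply] using hrow j
  have hleft : ∑ i, ∑ j, M i j * ∑ c, X i c ^ 2 = 0 := by
    simp [← Finset.sum_mul, hrow]
  have hright : ∑ i, ∑ j, M i j * ∑ c, X j c ^ 2 = 0 := by
    rw [Finset.sum_comm]
    simp [← Finset.sum_mul, hcol]
  have hexpand : ∑ i, ∑ j, -(M i j * rowDist X i j ^ 2) =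
      2 * (∑ i, ∑ j, M i j * ∑ c, X i c * X j c) - (∑ i, ∑ j, M i j * ∑ c, X i c ^ 2)
        - ∑ i, ∑ j, M i j * ∑ c, X j c ^ 2 := by
    simp only [rowDist_sq, Finset.mul_sum, ← Finset.sum_sub_distrib, ← Finset.sum_neg_distrib]
    refine Finset.sum_congr rfl fun i _ => Finset.sum_congr rfl fun j _ =>
      Finset.sum_congr rfl fun c _ => ?_
    ring
  have hpairs := sum_sum_eq_two_mul_sum_lt (fun i j => -(M i j * rowDist X i j ^ 2))
    (fun i j => by rw [hM.apply i j, rowDist_comm]) (fun i => by simp [rowDist])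
  linarith

/-- decomposition of the raw stress:
`σ(X) = Σ_{i<j} W_{i,j}·Δ_{i,j}² + tr(Xᵀ·L·X) − 2·tr(Xᵀ·B(X)·X)`. -/
theorem stmt_12 (N d : ℕ)
    (W Δ : Matrix (Fin N) (Fin N) ℝ) (hW : W.IsSymm) (hΔ : Δ.IsSymm)
    (L : Matrix (Fin N) (Fin N) ℝ)
    (hL : L = Matrix.diagonal (fun i => ∑ j, W i j) - W)
    (X : Matrix (Fin N) (Fin d) ℝ)
    (B : Matrix (Fin N) (Fin N) ℝ)
    (hBoff : ∀ i j, i ≠ j → B i j =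
      if rowDist X i j ≠ 0 then -(W i j * Δ i j) / rowDist X i j else 0)
    (hBdiag : ∀ i, B i i = -∑ k ∈ univ.erase i, B i k) :
    (∑ i : Fin N, ∑ j : Fin N,
      if i < j then W i j * (Δ i j - rowDist X i j) ^ 2 else 0) =
    (∑ i : Fin N, ∑ j : Fin N, if i < j then W i j * (Δ i j) ^ 2 else 0) +
      Matrix.trace (Xᵀ * L * X) - 2 * Matrix.trace (Xᵀ * B * X) := by
  have hLsymm : L.IsSymm := by
    rw [hL]
    exact (Matrix.isSymm_diagonal _).sub hW
  have hLrow : ∀ i, ∑ j, L i j = 0 := fun i => by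
    simp [hL, Matrix.diagonal_apply]
  have hBsymm : B.IsSymm := by
    refine Matrix.IsSymm.ext fun i j => ?_
    rcases eq_or_ne i j with rfl | h
    · rfl
    · rw [hBoff i j h, hBoff j i h.symm, rowDist_comm X j i, hW.apply i j, hΔ.apply i j]
  have hBrow : ∀ i, ∑ j, B i j = 0 := fun i => by
    rw [← Finset.add_sum_erase univ (B i) (mem_univ i), hBdiag]
    exact neg_add_cancel _
  rw [trace_transpose_mul_mul_eq_sum_lt L hLsymm hLrow,
    trace_transpose_mul_mul_eq_sum_lt B hBsymm hBrow]
  simp only [Finset.mul_sum, ← Finset.sum_add_distrib, ← Finset.sum_sub_distrib]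
  refine Finset.sum_congr rfl fun i _ => Finset.sum_congr rfl fun j _ => ?_
  by_cases h : i < j
  · have hLij : L i j = -W i j := by simp [hL, Matrix.diagonal_apply_ne _ h.ne]
    have hBij : B i j * rowDist X i j ^ 2 = -(W i j * Δ i j * rowDist X i j) := by
      rw [hBoff i j h.ne]
      by_cases hr : rowDist X i j = 0
      · simp [hr]
      · rw [if_pos hr]
        field_simp
    simp only [h, if_true, hLij, hBij]
    ring
  · simp [h]
end
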